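/- arXiv:2605.20719 — 2 statements merged into one kernel-verified Lean document; each statement's English description precedes it below -/
import Mathlib

section
/- Let μ be the Haar measure on the additive group of ℚ_2 normalized so that ℤ_2 has measure 1. Then ∫_{E ∩ Y_1} |1 − y|_2^{−1} |y|_2^{−1/2} dμ(y) = 1/4. -/
open MeasureTheory

/-- The unit part `u = y · 2^{-v₂(y)}` of a 2-adic number `y`. -/
noncomputable def unitPart (y : ℚ_[2]) : ℚ_[2] := y * (2 : ℚ_[2]) ^ (-y.valuation)

/-- `Y₁ = {y ∈ ℚ₂^× : v₂(y) even, u ≡ 1 (mod 8)}`. -/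
def Yone : Set ℚ_[2] := {y | y ≠ 0 ∧ Even y.valuation ∧ ‖unitPart y - 1‖ ≤ 8⁻¹}

/-- `E = {y ∈ ℚ₂, y ≠ 1 : v₂(1-y) even, v₂(1-y) ≤ 2}`. -/
def Eset : Set ℚ_[2] := {y | y ≠ 1 ∧ Even (1 - y).valuation ∧ (1 - y).valuation ≤ 2}

/-- Every 2-adic integer is congruent to `0` or `1` modulo the maximal ideal. -/
lemma norm_lt_one_or_norm_sub_one_lt_one {x : ℚ_[2]} (hx : ‖x‖ ≤ 1) :
    ‖x‖ < 1 ∨ ‖x - 1‖ < 1 := by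
  obtain ⟨z, rfl⟩ : ∃ z : ℤ_[2], (z : ℚ_[2]) = x := ⟨⟨x, hx⟩, rfl⟩
  obtain ⟨n, hn, h⟩ := PadicInt.exists_mem_range z
  rw [PadicInt.maximalIdeal_eq_span_p, Ideal.mem_span_singleton,
    ← PadicInt.norm_lt_one_iff_dvd, PadicInt.norm_def] at h
  interval_cases n
  · rw [Nat.cast_zero, sub_zero] at h
    exact .inl h
  · rw [Nat.cast_one, PadicInt.coe_sub, PadicInt.coe_one] at h
    exact .inr h

lemma norm_two_zpow (n : ℤ) : ‖(2 : ℚ_[2]) ^ n‖ = 2 ^ (-n) := by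
  exact_mod_cast Padic.norm_p_zpow (p := 2) n

lemma norm_le_zpow_iff_norm_lt_zpow_add_one (x : ℚ_[2]) (n : ℤ) :
    ‖x‖ ≤ 2 ^ n ↔ ‖x‖ < 2 ^ (n + 1) := by
  exact_mod_cast Padic.norm_le_pow_iff_norm_lt_pow_add_one x n

lemma closedBall_zpow_add_one (n : ℤ) :
    Metric.closedBall (0 : ℚ_[2]) (2 ^ (n + 1)) =
      Metric.closedBall 0 (2 ^ n) ∪ Metric.closedBall (2 ^ (-(n + 1))) (2 ^ n) := by
  have hpos : (0 : ℝ) < 2 ^ (n + 1) := by positivity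
  ext x
  simp only [Set.mem_union, mem_closedBall_iff_norm, sub_zero,
    norm_le_zpow_iff_norm_lt_zpow_add_one _ n]
  constructor
  · intro hx
    have key : ∀ y : ℚ_[2], ‖y * 2 ^ (n + 1)‖ * 2 ^ (n + 1) = ‖y‖ := fun y ↦ by
      rw [norm_mul, norm_two_zpow, mul_assoc, ← zpow_add₀ two_ne_zero]
      simp
    have hx' : ‖x * 2 ^ (n + 1)‖ ≤ 1 := by
      rw [← mul_le_mul_iff_left₀ hpos, key, one_mul]
      exact hx
    refine (norm_lt_one_or_norm_sub_one_lt_one hx').imp (fun h ↦ ?_) fun h ↦ ?_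
    · rwa [← mul_lt_mul_iff_left₀ hpos, key, one_mul] at h
    · have : x * 2 ^ (n + 1) - 1 = (x - 2 ^ (-(n + 1))) * 2 ^ (n + 1) := by
        rw [sub_mul, ← zpow_add₀ two_ne_zero]
        simp
      rwa [this, ← mul_lt_mul_iff_left₀ hpos, key, one_mul] at h
  · rintro (h | h)
    · exact h.le
    · have := Padic.nonarchimedean (x - 2 ^ (-(n + 1))) (2 ^ (-(n + 1)))
      rw [sub_add_cancel, norm_two_zpow, neg_neg] at this
      exact this.trans (max_le h.le le_rfl)

lemma disjoint_closedBall_zpow (n : ℤ) :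
    Disjoint (Metric.closedBall (0 : ℚ_[2]) (2 ^ n))
      (Metric.closedBall (2 ^ (-(n + 1))) (2 ^ n)) := by
  rw [Set.disjoint_left]
  intro x hx hx'
  rw [mem_closedBall_iff_norm, norm_le_zpow_iff_norm_lt_zpow_add_one] at hx hx'
  rw [sub_zero] at hx
  have h : ‖(2 : ℚ_[2]) ^ (-(n + 1))‖ = 2 ^ (n + 1) := by rw [norm_two_zpow, neg_neg]
  rw [← h] at hx hx'
  exact hx.ne (Padic.norm_eq_of_norm_sub_lt_right hx')

section Measure

variable [MeasurableSpace ℚ_[2]] [BorelSpace ℚ_[2]] (μ : Measure ℚ_[2]) [μ.IsAddHaarMeasure]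

lemma measureReal_closedBall_eq_center_zero (a : ℚ_[2]) (r : ℝ) :
    μ.real (Metric.closedBall a r) = μ.real (Metric.closedBall 0 r) := by
  rw [measureReal_def, measureReal_def, Measure.addHaar_closedBall_center]

lemma measureReal_closedBall_zpow_add_one (n : ℤ) :
    μ.real (Metric.closedBall (0 : ℚ_[2]) (2 ^ (n + 1))) =
      2 * μ.real (Metric.closedBall (0 : ℚ_[2]) (2 ^ n)) := by
  rw [closedBall_zpow_add_one, measureReal_union (disjoint_closedBall_zpow n)
    Metric.isClosed_closedBall.measurableSet (isCompact_closedBall _ _).measure_ne_top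
    (isCompact_closedBall _ _).measure_ne_top, measureReal_closedBall_eq_center_zero μ (2 ^ _),
    two_mul]

/-- A ball of radius `2 ^ n` in `ℚ₂` has measure `2 ^ n`. -/
lemma measureReal_closedBall_zpow (hvol : μ {x : ℚ_[2] | ‖x‖ ≤ 1} = 1) (a : ℚ_[2]) (n : ℤ) :
    μ.real (Metric.closedBall a (2 ^ n)) = 2 ^ n := by
  rw [measureReal_closedBall_eq_center_zero]
  induction n with
  | zero =>
    have : Metric.closedBall (0 : ℚ_[2]) (2 ^ (0 : ℤ)) = {x : ℚ_[2] | ‖x‖ ≤ 1} := by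
      ext; simp
    rw [this, measureReal_def, hvol]
    simp
  | succ n ih =>
    rw [measureReal_closedBall_zpow_add_one, ih, zpow_add_one₀ two_ne_zero, mul_comm]
  | pred n ih =>
    have h := measureReal_closedBall_zpow_add_one μ (-(n : ℤ) - 1)
    rw [sub_add_cancel, ih] at h
    have h' := zpow_sub_one₀ (two_ne_zero (α := ℝ)) (-(n : ℤ))
    linarith

end Measure

lemma valuation_eq_of_norm_eq {x : ℚ_[2]} {n : ℤ} (h : ‖x‖ = 2 ^ (-n)) : x.valuation = n := by
  have hx : x ≠ 0 := by
    rintro rfl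
    rw [norm_zero] at h
    exact (zpow_ne_zero _ two_ne_zero) h.symm
  have h' := Padic.norm_eq_zpow_neg_valuation hx
  rw [h] at h'
  have := zpow_right_injective₀ (a := (2 : ℝ)) (by norm_num) (by norm_num)
    (a₁ := -n) (a₂ := -x.valuation) (by exact_mod_cast h')
  omega

/-- The coset `4 ^ k (1 + 8 ℤ₂)`. -/
def shell (k : ℤ) : Set ℚ_[2] := Metric.closedBall (2 ^ (2 * k)) (2 ^ (-(2 * k) - 3))

lemma norm_of_mem_shell {k : ℤ} {y : ℚ_[2]} (hy : y ∈ shell k) : ‖y‖ = 2 ^ (-(2 * k)) := by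
  rw [shell, mem_closedBall_iff_norm] at hy
  rw [← norm_two_zpow]
  refine Padic.norm_eq_of_norm_sub_lt_right (hy.trans_lt ?_)
  rw [norm_two_zpow]
  exact zpow_lt_zpow_right₀ (by norm_num) (by omega)

lemma mem_Yone_iff {y : ℚ_[2]} : y ∈ Yone ↔ ∃ k, y ∈ shell k := by
  have key (k : ℤ) (hk : y.valuation = 2 * k) :
      ‖unitPart y - 1‖ ≤ 8⁻¹ ↔ y ∈ shell k := by
    have hpos : (0 : ℝ) < 2 ^ (-(2 * k)) := by positivity
    have h1 : y - 2 ^ (2 * k) = 2 ^ (2 * k) * (unitPart y - 1) := by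
      rw [unitPart, hk, mul_sub, mul_left_comm, ← zpow_add₀ two_ne_zero]
      simp
    rw [shell, mem_closedBall_iff_norm, h1, norm_mul, norm_two_zpow, zpow_sub₀ two_ne_zero,
      div_eq_mul_inv, mul_le_mul_iff_right₀ hpos]
    norm_num
  constructor
  · rintro ⟨-, ⟨k, hk⟩, h⟩
    rw [← two_mul] at hk
    exact ⟨k, (key k hk).1 h⟩
  · rintro ⟨k, hk⟩
    have hn := norm_of_mem_shell hk
    have hv := valuation_eq_of_norm_eq hn
    refine ⟨?_, ⟨k, by omega⟩, (key k hv).2 hk⟩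
    rintro rfl
    rw [norm_zero] at hn
    exact (zpow_ne_zero _ two_ne_zero) hn.symm

lemma norm_one_sub_of_mem_shell {k : ℤ} (hk : k ≠ 0) {y : ℚ_[2]} (hy : y ∈ shell k) :
    ‖1 - y‖ = 2 ^ (-(min 0 (2 * k))) := by
  have hn := norm_of_mem_shell hy
  rcases hk.lt_or_gt with h | h
  · have hlt : (1 : ℝ) < ‖y‖ := by
      rw [hn]
      exact one_lt_zpow₀ (by norm_num) (by omega)
    rw [sub_eq_add_neg, Padic.add_eq_max_of_ne (by simpa using hlt.ne),
      norm_neg, norm_one, max_eq_right hlt.le, hn, min_eq_right (by omega)]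
  · have hlt : ‖y‖ < (1 : ℝ) := by
      rw [hn]
      exact zpow_lt_one_of_neg₀ (by norm_num) (by omega)
    rw [sub_eq_add_neg, Padic.add_eq_max_of_ne (by simpa using hlt.ne'),
      norm_neg, norm_one, max_eq_left hlt.le, min_eq_left (by omega)]
    simp

lemma mem_Eset_iff_of_mem_shell {k : ℤ} {y : ℚ_[2]} (hy : y ∈ shell k) :
    y ∈ Eset ↔ k ≠ 0 := by
  constructor
  · rintro ⟨h1, -, h2⟩ rfl
    rw [shell, mem_closedBall_iff_norm, norm_sub_rev] at hy
    rw [mul_zero, zpow_zero, Padic.norm_eq_zpow_neg_valuation (sub_ne_zero.2 h1.symm)] at hy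
    have := (zpow_le_zpow_iff_right₀ (a := (2 : ℝ)) (by norm_num)).1 (by exact_mod_cast hy)
    omega
  · intro hk
    have hn := norm_one_sub_of_mem_shell hk hy
    have hv := valuation_eq_of_norm_eq hn
    refine ⟨?_, ⟨min 0 k, by omega⟩, by omega⟩
    rintro rfl
    rw [sub_self, norm_zero] at hn
    exact (zpow_ne_zero _ two_ne_zero) hn.symm

/-- The cosets `4 ^ k (1 + 8 ℤ₂)` for `k ≠ 0`, and `∅` for `k = 0`. -/
def puncturedShell (k : ℤ) : Set ℚ_[2] := {y | k ≠ 0 ∧ y ∈ shell k}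

lemma Eset_inter_Yone : Eset ∩ Yone = ⋃ k, puncturedShell k := by
  ext y
  simp only [Set.mem_inter_iff, mem_Yone_iff, Set.mem_iUnion, puncturedShell, Set.mem_ofPred_eq]
  constructor
  · rintro ⟨hE, k, hk⟩
    exact ⟨k, (mem_Eset_iff_of_mem_shell hk).1 hE, hk⟩
  · rintro ⟨k, h0, hk⟩
    exact ⟨(mem_Eset_iff_of_mem_shell hk).2 h0, k, hk⟩

lemma puncturedShell_zero : puncturedShell 0 = ∅ := by
  simp [puncturedShell]

lemma puncturedShell_of_ne {k : ℤ} (hk : k ≠ 0) : puncturedShell k = shell k := by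
  simp [puncturedShell, hk]

lemma pairwise_disjoint_puncturedShell : Pairwise (Function.onFun Disjoint puncturedShell) := by
  intro j k hjk
  rw [Function.onFun, Set.disjoint_left]
  rintro y ⟨-, hj⟩ ⟨-, hk⟩
  have h1 := valuation_eq_of_norm_eq (norm_of_mem_shell hj)
  have h2 := valuation_eq_of_norm_eq (norm_of_mem_shell hk)
  omega

lemma integrand_of_mem_puncturedShell {k : ℤ} {y : ℚ_[2]} (hy : y ∈ puncturedShell k) :
    ‖1 - y‖⁻¹ * ‖y‖ ^ (-(1/2) : ℝ) = 2 ^ (min 0 (2 * k) + k) := by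
  rw [norm_one_sub_of_mem_shell hy.1 hy.2, norm_of_mem_shell hy.2, ← zpow_neg, neg_neg,
    zpow_add₀ two_ne_zero, ← Real.rpow_intCast 2 (-(2 * k)), ← Real.rpow_mul zero_le_two,
    ← Real.rpow_intCast 2 k]
  congr 2
  push_cast
  ring

lemma measure_puncturedShell_ne_top [MeasurableSpace ℚ_[2]] (μ : Measure ℚ_[2])
    [IsFiniteMeasureOnCompacts μ] (k : ℤ) : μ (puncturedShell k) ≠ ⊤ :=
  measure_ne_top_of_subset (fun _ hy ↦ hy.2) (isCompact_closedBall _ _).measure_ne_top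

section Integral

variable [MeasurableSpace ℚ_[2]] [BorelSpace ℚ_[2]] (μ : Measure ℚ_[2]) [μ.IsAddHaarMeasure]

lemma measurableSet_puncturedShell (k : ℤ) : MeasurableSet (puncturedShell k) := by
  rcases eq_or_ne k 0 with rfl | hk
  · rw [puncturedShell_zero]
    exact MeasurableSet.empty
  · rw [puncturedShell_of_ne hk]
    exact Metric.isClosed_closedBall.measurableSet

lemma integrableOn_puncturedShell (k : ℤ) :
    IntegrableOn (fun y : ℚ_[2] ↦ ‖1 - y‖⁻¹ * ‖y‖ ^ (-(1/2) : ℝ)) (puncturedShell k) μ :=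
  (integrableOn_const (measure_puncturedShell_ne_top μ k)).congr_fun
    (fun _ hy ↦ (integrand_of_mem_puncturedShell hy).symm) (measurableSet_puncturedShell k)

lemma setIntegral_puncturedShell (hvol : μ {x : ℚ_[2] | ‖x‖ ≤ 1} = 1) (k : ℤ) :
    ∫ y in puncturedShell k, ‖1 - y‖⁻¹ * ‖y‖ ^ (-(1/2) : ℝ) ∂μ =
      if k = 0 then 0 else 2 ^ (-|k| - 3) := by
  split_ifs with hk
  · rw [hk, puncturedShell_zero, Measure.restrict_empty, integral_zero_measure]
  · rw [setIntegral_congr_fun (measurableSet_puncturedShell k)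
      fun _ hy ↦ integrand_of_mem_puncturedShell hy, setIntegral_const, puncturedShell_of_ne hk,
      shell, measureReal_closedBall_zpow μ hvol, smul_eq_mul, ← zpow_add₀ two_ne_zero]
    congr 1
    rcases abs_cases k with h | h <;> omega

end Integral

lemma hasSum_two_zpow_neg_abs :
    HasSum (fun k : ℤ ↦ if k = 0 then (0 : ℝ) else 2 ^ (-|k| - 3)) (1 / 4) := by
  have key : HasSum (fun n : ℕ ↦ (2 : ℝ) ^ (-((n : ℤ) + 1) - 3)) (1 / 8) := by
    have h := hasSum_geometric_two.mul_left (1 / 16 : ℝ)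
    rw [show (1 / 16 : ℝ) * 2 = 1 / 8 by norm_num] at h
    have hterm (n : ℕ) : (2 : ℝ) ^ (-((n : ℤ) + 1) - 3) = 1 / 16 * (1 / 2) ^ n := by
      rw [show -((n : ℤ) + 1) - 3 = -4 + -n by ring, zpow_add₀ two_ne_zero, zpow_neg _ (n : ℤ),
        zpow_natCast, one_div_pow]
      norm_num
    simpa only [hterm] using h
  have habs (n : ℕ) : |(n : ℤ) + 1| = n + 1 := abs_of_nonneg (by positivity)
  have hne (n : ℕ) : (n : ℤ) + 1 ≠ 0 := by positivity
  convert HasSum.of_add_one_of_neg_add_one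
    (f := fun k : ℤ ↦ if k = 0 then (0 : ℝ) else 2 ^ (-|k| - 3)) (m := 1 / 8) (m' := 1 / 8) ?_ ?_
    using 1
  · norm_num
  · simpa only [hne, if_false, habs] using key
  · simpa only [neg_eq_zero, hne, if_false, abs_neg, habs] using key

/-- With `μ` the additive Haar measure on `ℚ₂` normalized so that `ℤ₂` has
measure 1, `∫_{E ∩ Y₁} |1-y|₂⁻¹ |y|₂^{-1/2} dμ(y) = 1/4`. -/
theorem stmt12 [MeasurableSpace ℚ_[2]] [BorelSpace ℚ_[2]]
    (μ : Measure ℚ_[2]) [μ.IsAddHaarMeasure]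
    (hvol : μ {x : ℚ_[2] | ‖x‖ ≤ 1} = 1) :
    ∫ y in Eset ∩ Yone, ‖1 - y‖⁻¹ * ‖y‖ ^ (-(1/2) : ℝ) ∂μ = 1/4 := by
  have hsum : HasSum (fun k ↦ ∫ y in puncturedShell k, ‖1 - y‖⁻¹ * ‖y‖ ^ (-(1/2) : ℝ) ∂μ)
      (1 / 4) := by
    simpa only [setIntegral_puncturedShell μ hvol] using hasSum_two_zpow_neg_abs
  have hint : IntegrableOn (fun y : ℚ_[2] ↦ ‖1 - y‖⁻¹ * ‖y‖ ^ (-(1/2) : ℝ))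
      (⋃ k, puncturedShell k) μ := by
    refine integrableOn_iUnion_of_summable_integral_norm (integrableOn_puncturedShell μ) ?_
    refine hsum.summable.congr fun k ↦ ?_
    refine integral_congr_ae (.of_forall fun y ↦ ?_)
    exact (Real.norm_of_nonneg (by positivity)).symm
  rw [Eset_inter_Yone]
  exact (hasSum_integral_iUnion measurableSet_puncturedShell
    pairwise_disjoint_puncturedShell hint).unique hsum
end

section
/- Let μ be the Haar measure on the additive group of ℚ_2 normalized so that ℤ_2 has measure 1. Then ∫_{E ∩ Y_0} |1 − y|_2^{−1} (|y|_2′)^{−1/2} · (1 − (1/4)(|y|_2′)^{1/2} |1 − y|_2^{−1/2}) dμ(y) = 1/3. -/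
open scoped Classical

open MeasureTheory

/-- The modified 2-adic norm `|y|₂′`: writing `y = 2^v u` with `u ∈ ℤ₂ˣ`, it is `2^{-v}` if
`v` is even and `u ≡ 1 (mod 4)`; `2^{-v+2}` if `v` is even and `u ≡ 3 (mod 4)`; `2^{-v+3}`
if `v` is odd (and `0` at `y = 0`). -/
noncomputable def normMod (y : ℚ_[2]) : ℝ :=
  if y = 0 then 0
  else if Even y.valuation then
    (if ‖unitPart y - 1‖ ≤ 4⁻¹ then (2 : ℝ) ^ (-y.valuation) else (2 : ℝ) ^ (-y.valuation + 2))
  else (2 : ℝ) ^ (-y.valuation + 3)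

/-- `Y₀ = {y ∈ ℚ₂^× : v₂(y) even, u ≡ 3 (mod 4)} ∪ {y ∈ ℚ₂^× : v₂(y) odd}`. -/
def Yzero : Set ℚ_[2] :=
  {y | y ≠ 0 ∧ ((Even y.valuation ∧ ‖unitPart y - 3‖ ≤ 4⁻¹) ∨ ¬ Even y.valuation)}

open Metric

namespace TwoAdic

lemma norm_two_zpow (n : ℤ) : ‖(2 : ℚ_[2]) ^ n‖ = (2 : ℝ) ^ (-n) := by
  simpa using Padic.norm_p_zpow (p := 2) n

lemma norm_two : ‖(2 : ℚ_[2])‖ = 2⁻¹ := by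
  simpa using norm_two_zpow 1

lemma norm_eq_two_zpow_neg_iff {x : ℚ_[2]} {n : ℤ} :
    ‖x‖ = (2 : ℝ) ^ (-n) ↔ x ≠ 0 ∧ x.valuation = n := by
  constructor
  · intro h
    have hx : x ≠ 0 := by
      rintro rfl
      rw [norm_zero] at h
      exact (zpow_pos (two_pos : (0 : ℝ) < 2) (-n)).ne h
    refine ⟨hx, ?_⟩
    rw [Padic.norm_eq_zpow_neg_valuation hx, Nat.cast_ofNat] at h
    exact neg_injective (zpow_right_injective₀ two_pos (by norm_num) h)
  · rintro ⟨hx, rfl⟩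
    simpa using Padic.norm_eq_zpow_neg_valuation hx

lemma norm_sub_one_le_iff {z : ℚ_[2]} : ‖z - 1‖ ≤ 2⁻¹ ↔ ‖z‖ = 1 := by
  constructor
  · intro h
    have hne : ‖z - 1‖ ≠ ‖(1 : ℚ_[2])‖ := by
      rw [norm_one]
      exact (h.trans_lt (by norm_num)).ne
    have := Padic.add_eq_max_of_ne hne
    rw [sub_add_cancel, norm_one] at this
    rw [this]
    exact max_eq_right (h.trans (by norm_num))
  · intro h
    obtain ⟨n, hn, hmem⟩ := PadicInt.exists_mem_range (p := 2) ⟨z, h.le⟩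
    rw [IsLocalRing.mem_maximalIdeal, PadicInt.mem_nonunits, PadicInt.norm_def] at hmem
    have hlt : ‖z - n‖ < 1 := hmem
    interval_cases n
    · simp [h] at hlt
    · have := (Padic.norm_le_pow_iff_norm_lt_pow_add_one (z - 1) (-1)).2 (by simpa using hlt)
      simpa using this

/-- Multiplication by `2 ^ n` carries a ball around `c` to a ball around `c * 2 ^ n`. -/
lemma mem_closedBall_mul_two_zpow {y c : ℚ_[2]} {n k : ℤ} :
    y ∈ closedBall (c * 2 ^ n) ((2 : ℝ) ^ (-n + k)) ↔ ‖y * 2 ^ (-n) - c‖ ≤ (2 : ℝ) ^ k := by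
  have h : y - c * 2 ^ n = (y * 2 ^ (-n) - c) * 2 ^ n := by
    rw [sub_mul, mul_assoc, ← zpow_add₀ two_ne_zero, neg_add_cancel, zpow_zero, mul_one]
  rw [mem_closedBall_iff_norm, h, norm_mul, norm_two_zpow, zpow_add₀ two_ne_zero, mul_comm]
  exact mul_le_mul_iff_right₀ (by positivity)

lemma norm_mul_two_zpow_eq_one_iff {y : ℚ_[2]} {n : ℤ} :
    ‖y * 2 ^ (-n)‖ = 1 ↔ ‖y‖ = (2 : ℝ) ^ (-n) := by
  rw [norm_mul, norm_two_zpow, zpow_neg (2 : ℝ) (-n)]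
  exact mul_inv_eq_one₀ (by positivity)

lemma norm_eq_iff_mem_closedBall {y : ℚ_[2]} {n : ℤ} :
    ‖y‖ = (2 : ℝ) ^ (-n) ↔ y ∈ closedBall (2 ^ n) ((2 : ℝ) ^ (-n - 1)) := by
  rw [← norm_mul_two_zpow_eq_one_iff, ← norm_sub_one_le_iff, sub_eq_add_neg (-n),
    ← one_mul ((2 : ℚ_[2]) ^ n), mem_closedBall_mul_two_zpow, zpow_neg_one]

lemma norm_eq_one_of_norm_sub_three_le {z : ℚ_[2]} (h : ‖z - 3‖ ≤ 4⁻¹) : ‖z‖ = 1 := by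
  rw [← norm_sub_one_le_iff, show z - 1 = (z - 3) + 2 by ring]
  refine (Padic.nonarchimedean _ _).trans (max_le (h.trans (by norm_num)) norm_two.le)

lemma norm_sub_one_of_norm_sub_three_le {z : ℚ_[2]} (h : ‖z - 3‖ ≤ 4⁻¹) : ‖z - 1‖ = 2⁻¹ := by
  have hlt : ‖z - 3‖ < ‖(2 : ℚ_[2])‖ := by
    rw [norm_two]
    exact h.trans_lt (by norm_num)
  rw [show z - 1 = (z - 3) + 2 by ring, Padic.add_eq_max_of_ne hlt.ne, max_eq_right hlt.le,
    norm_two]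

/-- The part of `Y₀` of valuation `n`. -/
def layer (n : ℤ) : Set ℚ_[2] := {y | y ∈ Yzero ∧ y.valuation = n}

lemma layer_of_even {n : ℤ} (hn : Even n) :
    layer n = closedBall (3 * 2 ^ n) ((2 : ℝ) ^ (-n - 2)) := by
  ext y
  rw [sub_eq_add_neg (-n), mem_closedBall_mul_two_zpow,
    show (2 : ℝ) ^ (-2 : ℤ) = 4⁻¹ by norm_num]
  constructor
  · rintro ⟨⟨-, h | h⟩, rfl⟩
    · exact h.2
    · exact absurd hn h
  · intro h
    obtain ⟨h0, rfl⟩ := norm_eq_two_zpow_neg_iff.1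
      (norm_mul_two_zpow_eq_one_iff.1 (norm_eq_one_of_norm_sub_three_le h))
    exact ⟨⟨h0, Or.inl ⟨hn, h⟩⟩, rfl⟩

lemma layer_of_odd {n : ℤ} (hn : ¬ Even n) :
    layer n = closedBall (2 ^ n) ((2 : ℝ) ^ (-n - 1)) := by
  ext y
  rw [← norm_eq_iff_mem_closedBall, norm_eq_two_zpow_neg_iff]
  constructor
  · rintro ⟨h, rfl⟩
    exact ⟨h.1, rfl⟩
  · rintro ⟨h0, rfl⟩
    exact ⟨⟨h0, Or.inr hn⟩, rfl⟩

lemma norm_of_mem_layer {n : ℤ} {y : ℚ_[2]} (hy : y ∈ layer n) : ‖y‖ = (2 : ℝ) ^ (-n) :=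
  norm_eq_two_zpow_neg_iff.2 ⟨hy.1.1, hy.2⟩

lemma norm_one_sub_of_neg {n : ℤ} (hn : n < 0) {y : ℚ_[2]} (hy : y ∈ layer n) :
    ‖1 - y‖ = (2 : ℝ) ^ (-n) := by
  have hlt : ‖(1 : ℚ_[2])‖ < ‖y‖ := by
    rw [norm_of_mem_layer hy, norm_one]
    exact one_lt_zpow₀ (by norm_num) (by omega)
  rw [sub_eq_add_neg, Padic.add_eq_max_of_ne (by rw [norm_neg]; exact hlt.ne), norm_neg,
    max_eq_right hlt.le, norm_of_mem_layer hy]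

lemma norm_one_sub_of_pos {n : ℤ} (hn : 0 < n) {y : ℚ_[2]} (hy : y ∈ layer n) :
    ‖1 - y‖ = 1 := by
  have hlt : ‖y‖ < ‖(1 : ℚ_[2])‖ := by
    rw [norm_of_mem_layer hy, norm_one]
    exact zpow_lt_one_of_neg₀ (by norm_num) (by omega)
  rw [sub_eq_add_neg, Padic.add_eq_max_of_ne (by rw [norm_neg]; exact hlt.ne'), norm_neg,
    max_eq_left hlt.le, norm_one]

lemma normMod_of_even {n : ℤ} (hn : Even n) {y : ℚ_[2]} (hy : y ∈ layer n) :
    normMod y = (2 : ℝ) ^ (-n + 2) := by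
  obtain ⟨⟨h0, h⟩, rfl⟩ := hy
  have h3 : ‖unitPart y - 3‖ ≤ 4⁻¹ := (h.resolve_right (not_not.2 hn)).2
  have h1 : ¬ ‖unitPart y - 1‖ ≤ 4⁻¹ := by
    rw [norm_sub_one_of_norm_sub_three_le h3]
    norm_num
  simp only [normMod, h0, hn, h1, if_true, if_false]

lemma normMod_of_odd {n : ℤ} (hn : ¬ Even n) {y : ℚ_[2]} (hy : y ∈ layer n) :
    normMod y = (2 : ℝ) ^ (-n + 3) := by
  obtain ⟨⟨h0, -⟩, rfl⟩ := hy
  simp only [normMod, h0, hn, if_false]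

lemma disjoint_layer {m n : ℤ} (h : m ≠ n) : Disjoint (layer m) (layer n) :=
  Set.disjoint_left.2 fun _ hm hn => h (hm.2.symm.trans hn.2)

lemma mem_Eset_iff_of_mem_layer {n : ℤ} {y : ℚ_[2]} (hy : y ∈ layer n) :
    y ∈ Eset ↔ 0 < n ∨ (n < 0 ∧ Even n) := by
  have key : ∀ {m : ℤ}, ‖1 - y‖ = (2 : ℝ) ^ (-m) → (y ∈ Eset ↔ Even m ∧ m ≤ 2) := by
    intro m hm
    obtain ⟨h0, rfl⟩ := norm_eq_two_zpow_neg_iff.1 hm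
    exact and_iff_right (sub_ne_zero.1 h0).symm
  rcases lt_trichotomy n 0 with hn | rfl | hn
  · rw [key (norm_one_sub_of_neg hn hy)]
    constructor
    · exact fun h => Or.inr ⟨hn, h.1⟩
    · rintro (h | h)
      · omega
      · exact ⟨h.2, by omega⟩
  · have h3 : ‖y - 3‖ ≤ 4⁻¹ := by
      rw [layer_of_even Even.zero, mem_closedBall_iff_norm] at hy
      norm_num at hy
      linarith
    have h1 : ‖1 - y‖ = (2 : ℝ) ^ (-1 : ℤ) := by
      rw [norm_sub_rev, norm_sub_one_of_norm_sub_three_le h3, zpow_neg_one]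
    simp [key h1]
  · rw [key (m := 0) (by simpa using norm_one_sub_of_pos hn hy)]
    simp [hn]

/-- The valuations occurring in `E ∩ Y₀`: negative even, positive odd, positive even. -/
def index : ℕ ⊕ ℕ ⊕ ℕ → ℤ
  | .inl k => -(2 * (k + 1))
  | .inr (.inl k) => 2 * k + 1
  | .inr (.inr k) => 2 * (k + 1)

lemma index_injective : Function.Injective index := by
  rintro (i | i | i) (j | j | j) h <;> simp only [index] at h <;>
    first | omega | (congr; omega)

lemma mem_range_index {n : ℤ} : n ∈ Set.range index ↔ 0 < n ∨ (n < 0 ∧ Even n) := by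
  constructor
  · rintro ⟨i | i | i, rfl⟩ <;> simp only [index, Int.even_iff] <;> omega
  · rintro (h | ⟨h, he⟩)
    · rcases Int.even_or_odd' n with ⟨k, rfl | rfl⟩
      · exact ⟨.inr (.inr (k - 1).toNat), by simp only [index]; omega⟩
      · exact ⟨.inr (.inl k.toNat), by simp only [index]; omega⟩
    · obtain ⟨k, rfl⟩ := he.two_dvd
      exact ⟨.inl (-k - 1).toNat, by simp only [index]; omega⟩

lemma Eset_inter_Yzero : Eset ∩ Yzero = ⋃ i, layer (index i) := by
  ext y
  rw [Set.mem_iUnion]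
  constructor
  · rintro ⟨hE, hY⟩
    have hy : y ∈ layer y.valuation := ⟨hY, rfl⟩
    obtain ⟨i, hi⟩ := mem_range_index.2 ((mem_Eset_iff_of_mem_layer hy).1 hE)
    exact ⟨i, hY, hi.symm⟩
  · rintro ⟨i, hi⟩
    exact ⟨(mem_Eset_iff_of_mem_layer hi).2 (mem_range_index.1 ⟨i, rfl⟩), hi.1⟩

lemma measure_layer_ne_top [MeasurableSpace ℚ_[2]] (μ : Measure ℚ_[2]) [μ.IsAddHaarMeasure]
    (n : ℤ) : μ (layer n) ≠ ⊤ := by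
  by_cases hn : Even n
  · rw [layer_of_even hn]
    exact measure_closedBall_lt_top.ne
  · rw [layer_of_odd hn]
    exact measure_closedBall_lt_top.ne

section Measure

variable [MeasurableSpace ℚ_[2]] [BorelSpace ℚ_[2]]

lemma measurableSet_layer (n : ℤ) : MeasurableSet (layer n) := by
  by_cases hn : Even n
  · rw [layer_of_even hn]
    exact isClosed_closedBall.measurableSet
  · rw [layer_of_odd hn]
    exact isClosed_closedBall.measurableSet

variable (μ : Measure ℚ_[2]) [μ.IsAddHaarMeasure]

lemma measureReal_closedBall_center (a : ℚ_[2]) (r : ℝ) :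
    μ.real (closedBall a r) = μ.real (closedBall 0 r) := by
  rw [Measure.real, Measure.real, ← measure_preimage_add μ a (closedBall a r)]
  congr 2
  ext x
  simp

/-- The ball of radius `2 ^ (n + 1)` splits into the ball of radius `2 ^ n` and a sphere, which is
a translate of it. -/
lemma measureReal_closedBall_succ (n : ℤ) :
    μ.real (closedBall (0 : ℚ_[2]) ((2 : ℝ) ^ (n + 1))) =
      2 * μ.real (closedBall (0 : ℚ_[2]) ((2 : ℝ) ^ n)) := by
  have hsphere : ∀ x : ℚ_[2], x ∈ closedBall ((2 : ℚ_[2]) ^ (-(n + 1))) ((2 : ℝ) ^ n) ↔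
      ‖x‖ = (2 : ℝ) ^ (n + 1) := by
    intro x
    have := norm_eq_iff_mem_closedBall (y := x) (n := -(n + 1))
    rw [neg_neg, add_sub_cancel_right] at this
    exact this.symm
  have hlt : (2 : ℝ) ^ n < 2 ^ (n + 1) := zpow_lt_zpow_right₀ (by norm_num) (by omega)
  have hunion : closedBall (0 : ℚ_[2]) ((2 : ℝ) ^ (n + 1)) =
      closedBall 0 ((2 : ℝ) ^ n) ∪ closedBall ((2 : ℚ_[2]) ^ (-(n + 1))) ((2 : ℝ) ^ n) := by
    ext x
    have hle := Padic.norm_le_pow_iff_norm_lt_pow_add_one x n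
    rw [Nat.cast_ofNat] at hle
    rw [Set.mem_union, hsphere, mem_closedBall_zero_iff, mem_closedBall_zero_iff, hle,
      ← le_iff_lt_or_eq]
  have hdisj : Disjoint (closedBall (0 : ℚ_[2]) ((2 : ℝ) ^ n))
      (closedBall ((2 : ℚ_[2]) ^ (-(n + 1))) ((2 : ℝ) ^ n)) := by
    refine Set.disjoint_left.2 fun x hx hx' => ?_
    rw [mem_closedBall_zero_iff] at hx
    rw [hsphere] at hx'
    linarith
  rw [hunion, measureReal_union hdisj isClosed_closedBall.measurableSet
    measure_closedBall_lt_top.ne measure_closedBall_lt_top.ne,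
    measureReal_closedBall_center μ (2 ^ (-(n + 1))), two_mul]

variable {μ}

lemma measureReal_closedBall (hvol : μ {x : ℚ_[2] | ‖x‖ ≤ 1} = 1)
    (a : ℚ_[2]) (n : ℤ) :
    μ.real (closedBall a ((2 : ℝ) ^ n)) = (2 : ℝ) ^ n := by
  rw [measureReal_closedBall_center]
  induction n with
  | zero =>
    have : closedBall (0 : ℚ_[2]) 1 = {x | ‖x‖ ≤ 1} := by
      ext x
      simp
    rw [zpow_zero, this, Measure.real, hvol, ENNReal.toReal_one]
  | succ k ih => rw [measureReal_closedBall_succ, ih, zpow_add_one₀ two_ne_zero, mul_comm]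
  | pred k ih =>
    have := measureReal_closedBall_succ μ (-(k : ℤ) - 1)
    rw [sub_add_cancel, ih] at this
    have hz := zpow_sub_one₀ (two_ne_zero : (2 : ℝ) ≠ 0) (-(k : ℤ))
    linarith

lemma measureReal_layer_of_even (hvol : μ {x : ℚ_[2] | ‖x‖ ≤ 1} = 1)
    {n : ℤ} (hn : Even n) :
    μ.real (layer n) = (2 : ℝ) ^ (-n - 2) := by
  rw [layer_of_even hn, measureReal_closedBall hvol]

lemma measureReal_layer_of_odd (hvol : μ {x : ℚ_[2] | ‖x‖ ≤ 1} = 1)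
    {n : ℤ} (hn : ¬ Even n) :
    μ.real (layer n) = (2 : ℝ) ^ (-n - 1) := by
  rw [layer_of_odd hn, measureReal_closedBall hvol]

end Measure

/-- A nonnegative function that is constant on each of countably many disjoint sets of finite
measure is integrated over their union by summing. -/
lemma setIntegral_iUnion_of_hasSum {X ι : Type*} [MeasurableSpace X] {μ : Measure X} [Countable ι]
    {s : ι → Set X} (hs : ∀ i, MeasurableSet (s i)) (hd : Pairwise (Function.onFun Disjoint s))
    (hfin : ∀ i, μ (s i) ≠ ⊤) {f : X → ℝ} {w : ι → ℝ} (hf : ∀ i, ∀ x ∈ s i, f x = w i)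
    (hw : ∀ i, 0 ≤ w i) {a : ℝ} (ha : HasSum (fun i => μ.real (s i) * w i) a) :
    ∫ x in ⋃ i, s i, f x ∂μ = a := by
  have hint : ∀ i, ∫ x in s i, f x ∂μ = μ.real (s i) * w i := fun i => by
    rw [setIntegral_congr_fun (hs i) (hf i), setIntegral_const, smul_eq_mul]
  have hnorm : ∀ i, ∫ x in s i, ‖f x‖ ∂μ = μ.real (s i) * w i := fun i => by
    rw [← hint i]
    refine setIntegral_congr_fun (hs i) fun x hx => ?_
    simp only [hf i x hx, Real.norm_of_nonneg (hw i)]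
  have hon : ∀ i, IntegrableOn f (s i) μ := fun i =>
    (integrableOn_const (hfin i)).congr_fun (fun x hx => (hf i x hx).symm) (hs i)
  have hsum : Summable fun i => ∫ x in s i, ‖f x‖ ∂μ := by
    simpa only [hnorm] using ha.summable
  have h := hasSum_integral_iUnion hs hd (integrableOn_iUnion_of_summable_integral_norm hon hsum)
  simp only [hint] at h
  exact h.unique ha

lemma two_zpow_rpow_half (j : ℤ) : ((2 : ℝ) ^ (2 * j)) ^ ((1 / 2) : ℝ) = 2 ^ j := by
  rw [← Real.sqrt_eq_rpow, mul_comm, zpow_mul, zpow_ofNat, Real.sqrt_sq (by positivity)]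

lemma two_zpow_rpow_neg_half (j : ℤ) : ((2 : ℝ) ^ (2 * j)) ^ (-(1 / 2) : ℝ) = 2 ^ (-j) := by
  rw [Real.rpow_neg (by positivity), two_zpow_rpow_half, zpow_neg]

/-- The integrand of the theorem. -/
noncomputable def integrand (y : ℚ_[2]) : ℝ :=
  ‖1 - y‖⁻¹ * normMod y ^ (-(1 / 2) : ℝ) *
    (1 - (1 / 4) * normMod y ^ ((1 / 2) : ℝ) * ‖1 - y‖ ^ (-(1 / 2) : ℝ))

/-- The value of the integrand on each layer. -/
noncomputable def weight : ℕ ⊕ ℕ ⊕ ℕ → ℝ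
  | .inl k => (1 / 32) * (1 / 8) ^ k
  | .inr (.inl k) => (1 / 2) * 2 ^ k - 1 / 4
  | .inr (.inr k) => 2 ^ k - 1 / 4

lemma weight_nonneg (i : ℕ ⊕ ℕ ⊕ ℕ) : 0 ≤ weight i := by
  have h (k : ℕ) : (1 : ℝ) ≤ 2 ^ k := one_le_pow₀ (by norm_num)
  rcases i with k | k | k <;> simp only [weight]
  · positivity
  · linarith [h k]
  · linarith [h k]

lemma integrand_eq_weight (i : ℕ ⊕ ℕ ⊕ ℕ) {y : ℚ_[2]} (hy : y ∈ layer (index i)) :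
    integrand y = weight i := by
  rcases i with k | k | k <;> simp only [index] at hy <;> unfold integrand
  · have hn : normMod y = (2 : ℝ) ^ (2 * ((k : ℤ) + 2)) := by
      rw [normMod_of_even (by simp) hy]
      exact congrArg _ (by ring)
    have h1 : ‖1 - y‖ = (2 : ℝ) ^ (2 * ((k : ℤ) + 1)) := by
      rw [norm_one_sub_of_neg (by omega) hy, neg_neg]
    rw [hn, h1, two_zpow_rpow_half, two_zpow_rpow_neg_half, two_zpow_rpow_neg_half, weight]
    have e8 : (8 : ℝ) ^ k = (2 ^ k) ^ 3 := by rw [← pow_mul, mul_comm, pow_mul]; norm_num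
    simp only [zpow_neg, zpow_add₀ (two_ne_zero : (2 : ℝ) ≠ 0), mul_add, two_mul, zpow_natCast,
      one_div, inv_pow, e8]
    field_simp
    norm_num
  · have hn : normMod y = (2 : ℝ) ^ (2 * (1 - (k : ℤ))) := by
      rw [normMod_of_odd (by simp [parity_simps]) hy]
      exact congrArg _ (by ring)
    rw [hn, norm_one_sub_of_pos (by omega) hy, two_zpow_rpow_half, two_zpow_rpow_neg_half, weight]
    simp only [zpow_neg, zpow_sub₀ (two_ne_zero : (2 : ℝ) ≠ 0), zpow_natCast, Real.one_rpow,
      zpow_one]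
    field_simp
  · have hn : normMod y = (2 : ℝ) ^ (2 * (-(k : ℤ))) := by
      rw [normMod_of_even (by simp) hy]
      exact congrArg _ (by ring)
    rw [hn, norm_one_sub_of_pos (by omega) hy, two_zpow_rpow_half, two_zpow_rpow_neg_half, weight]
    simp only [zpow_neg, neg_neg, zpow_natCast, Real.one_rpow]
    field_simp

lemma hasSum_measureReal_mul_weight [MeasurableSpace ℚ_[2]] [BorelSpace ℚ_[2]]
    {μ : Measure ℚ_[2]} [μ.IsAddHaarMeasure] (hvol : μ {x : ℚ_[2] | ‖x‖ ≤ 1} = 1) :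
    HasSum (fun i => μ.real (layer (index i)) * weight i) (1 / 3) := by
  have e4 (k : ℕ) : (4 : ℝ) ^ k = (2 ^ k) ^ 2 := by rw [← pow_mul, mul_comm, pow_mul]; norm_num
  have e8 (k : ℕ) : (8 : ℝ) ^ k = (2 ^ k) ^ 3 := by rw [← pow_mul, mul_comm, pow_mul]; norm_num
  have g2 : HasSum (fun k : ℕ => ((1 / 2 : ℝ)) ^ k) 2 := hasSum_geometric_two
  have g4 : HasSum (fun k : ℕ => ((1 / 4 : ℝ)) ^ k) (4 / 3) := by
    convert hasSum_geometric_of_lt_one (r := (1 / 4 : ℝ)) (by norm_num) (by norm_num) using 1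
    norm_num
  have hA : HasSum (fun k : ℕ => μ.real (layer (index (.inl k))) * weight (.inl k)) (1 / 16) := by
    rw [show (1 / 16 : ℝ) = 1 / 32 * 2 by norm_num]
    convert! g2.mul_left (1 / 32) using 2 with k
    simp only [index, weight]
    rw [measureReal_layer_of_even hvol (by simp)]
    simp only [neg_neg, zpow_sub₀ (two_ne_zero : (2 : ℝ) ≠ 0),
      zpow_add₀ (two_ne_zero : (2 : ℝ) ≠ 0), mul_add, two_mul, zpow_natCast, one_div, inv_pow, e8]
    field_simp
  have hB : HasSum (fun k : ℕ => μ.real (layer (index (.inr (.inl k)))) * weight (.inr (.inl k)))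
      (1 / 6) := by
    rw [show (1 / 6 : ℝ) = 1 / 8 * 2 - 1 / 16 * (4 / 3) by norm_num]
    convert! (g2.mul_left (1 / 8)).sub (g4.mul_left (1 / 16)) using 2 with k
    simp only [index, weight]
    rw [measureReal_layer_of_odd hvol (by simp [parity_simps])]
    simp only [zpow_neg, zpow_sub₀ (two_ne_zero : (2 : ℝ) ≠ 0),
      zpow_add₀ (two_ne_zero : (2 : ℝ) ≠ 0), two_mul, zpow_natCast, one_div, inv_pow, e4]
    field_simp
    norm_num
    ring
  have hC : HasSum (fun k : ℕ => μ.real (layer (index (.inr (.inr k)))) * weight (.inr (.inr k)))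
      (5 / 48) := by
    rw [show (5 / 48 : ℝ) = 1 / 16 * 2 - 1 / 64 * (4 / 3) by norm_num]
    convert! (g2.mul_left (1 / 16)).sub (g4.mul_left (1 / 64)) using 2 with k
    simp only [index, weight]
    rw [measureReal_layer_of_even hvol (by simp)]
    simp only [zpow_neg, zpow_sub₀ (two_ne_zero : (2 : ℝ) ≠ 0),
      zpow_add₀ (two_ne_zero : (2 : ℝ) ≠ 0), mul_add, two_mul, zpow_natCast, one_div, inv_pow, e4]
    field_simp
    norm_num
    ring
  rw [show (1 / 3 : ℝ) = 1 / 16 + (1 / 6 + 5 / 48) by norm_num]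
  exact HasSum.sum (f := fun i => μ.real (layer (index i)) * weight i) hA
    (HasSum.sum (f := fun i => μ.real (layer (index (.inr i))) * weight (.inr i)) hB hC)

end TwoAdic

/-- With `μ` the additive Haar measure on `ℚ₂` normalized so that `ℤ₂` has
measure 1,
`∫_{E ∩ Y₀} |1-y|₂⁻¹ (|y|₂′)^{-1/2} (1 - (1/4)(|y|₂′)^{1/2}|1-y|₂^{-1/2}) dμ(y) = 1/3`. -/
theorem stmt15 [MeasurableSpace ℚ_[2]] [BorelSpace ℚ_[2]]
    (μ : Measure ℚ_[2]) [μ.IsAddHaarMeasure]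
    (hvol : μ {x : ℚ_[2] | ‖x‖ ≤ 1} = 1) :
    ∫ y in Eset ∩ Yzero,
        ‖1 - y‖⁻¹ * normMod y ^ (-(1/2) : ℝ) *
          (1 - (1/4) * normMod y ^ ((1/2) : ℝ) * ‖1 - y‖ ^ (-(1/2) : ℝ)) ∂μ = 1/3 := by
  rw [TwoAdic.Eset_inter_Yzero]
  exact TwoAdic.setIntegral_iUnion_of_hasSum (fun i => TwoAdic.measurableSet_layer _)
    (fun i j hij => TwoAdic.disjoint_layer (TwoAdic.index_injective.ne hij))
    (fun i => TwoAdic.measure_layer_ne_top μ _)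
    (fun i y hy => TwoAdic.integrand_eq_weight i hy) TwoAdic.weight_nonneg
    (TwoAdic.hasSum_measureReal_mul_weight hvol)
end
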